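/- Let G be an abelian group and C ⊆ sub(G)^ω a CMS-family. Let s ≥ 0 and d, d' ≥ 1 be integers, and let G₁, …, G_s, H₁, …, H_d, H'₁, …, H'_{d'} be subgroups of G. Suppose there is a subgroup H ⊆ G such that H_i + H'_{i'} = H for all i ∈ {1, …, d} and i' ∈ {1, …, d'}. If (G₁, …, G_s, H₁, …, H_d) ∈ C and (G₁, …, G_s, H'₁, …, H'_{d'}) ∈ C, then the tuple (G₁, …, G_s, H, …, H) with d + d' − 1 copies of H belongs to C. -/

import Mathlib

noncomputable section

/-- A CMS-family: a collection of finite tuples (lists) of subgroups of an abelian group `G`,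
closed under concatenation of last entries, extension by an arbitrary subgroup, and
permutation of entries. -/
structure IsCMSFamily (G : Type*) [AddCommGroup G] (C : Set (List (AddSubgroup G))) : Prop where
  concat : ∀ (L : List (AddSubgroup G)) (H H' : AddSubgroup G),
    L ++ [H] ∈ C → L ++ [H'] ∈ C → L ++ [H ⊔ H'] ∈ C
  mono : ∀ (L : List (AddSubgroup G)) (H : AddSubgroup G), L ∈ C → L ++ [H] ∈ C
  symm : ∀ L L' : List (AddSubgroup G), L ∈ C → L.Perm L' → L' ∈ C

namespace IsCMSFamily

variable {G : Type*} [AddCommGroup G] {C : Set (List (AddSubgroup G))}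

/-- A CMS-family is closed under appending arbitrary lists of subgroups. -/
theorem append_mem (hC : IsCMSFamily G C) {L : List (AddSubgroup G)} (hL : L ∈ C)
    (A : List (AddSubgroup G)) : L ++ A ∈ C := by
  induction A generalizing L with
  | nil => simpa using hL
  | cons a A ih => simpa using ih (hC.mono L a hL)

/-- If `L ++ A` and `L ++ B` belong to a CMS-family and every entry of `A` generates `K` together
with every entry of `B`, then `L` followed by `A.length + B.length - 1` copies of `K` belongs to
the family. -/
theorem append_replicate_mem (hC : IsCMSFamily G C) {K : AddSubgroup G}
    {L A B : List (AddSubgroup G)} (hK : ∀ a ∈ A, ∀ b ∈ B, a ⊔ b = K)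
    (hA : L ++ A ∈ C) (hB : L ++ B ∈ C) :
    L ++ List.replicate (A.length + B.length - 1) K ∈ C := by
  induction A generalizing L B with
  | nil => exact hC.append_mem (by simpa using hA) _
  | cons a A ihA =>
    induction B generalizing L with
    | nil => exact hC.append_mem (by simpa using hB) _
    | cons b B ihB =>
      have swap (M : List (AddSubgroup G)) (c : AddSubgroup G) :
          ((L ++ [c]) ++ M).Perm ((L ++ M) ++ [c]) := by
        simpa only [List.append_assoc] using
          (List.perm_append_comm (l₁ := [c]) (l₂ := M)).append_left L
      have ha : (L ++ [a]) ++ List.replicate (A.length + B.length) K ∈ C := by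
        refine ihA (B := b :: B) (fun x hx y hy ↦ hK x (.tail _ hx) y hy) (by simpa using hA) ?_
        exact hC.symm _ _ (hC.mono _ a hB) (swap _ a).symm
      have hb : (L ++ [b]) ++ List.replicate (A.length + B.length) K ∈ C := by
        have h := ihB (L := L ++ [b]) (fun x hx y hy ↦ hK x hx y (.tail _ hy))
          (hC.symm _ _ (hC.mono _ b hA) (swap _ b).symm) (by simpa using hB)
        simpa [Nat.add_right_comm] using h
      have h := hC.concat _ _ _ (hC.symm _ _ ha (swap _ a)) (hC.symm _ _ hb (swap _ b))
      have hlen : (a :: A).length + (b :: B).length - 1 = A.length + B.length + 1 := by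
        simp only [List.length_cons]
        omega
      rw [hK a (.head _) b (.head _)] at h
      rwa [hlen, List.replicate_succ', ← List.append_assoc]

end IsCMSFamily

/-- Let `C` be a CMS-family of tuples of subgroups of an abelian group `G`.
Suppose `H_i + H'_{i'} = K` for all `i, i'`. If `(G₁, …, G_s, H₁, …, H_d) ∈ C` and
`(G₁, …, G_s, H'₁, …, H'_{d'}) ∈ C`, then `(G₁, …, G_s, K, …, K)` with `d + d' − 1` copies
of `K` belongs to `C`. -/
theorem stmt13 {G : Type*} [AddCommGroup G] (C : Set (List (AddSubgroup G)))
    (hC : IsCMSFamily G C) (s d d' : ℕ) (hd : 1 ≤ d) (hd' : 1 ≤ d')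
    (Gs : Fin s → AddSubgroup G) (H : Fin d → AddSubgroup G) (H' : Fin d' → AddSubgroup G)
    (K : AddSubgroup G) (hK : ∀ (i : Fin d) (i' : Fin d'), H i ⊔ H' i' = K)
    (h1 : List.ofFn Gs ++ List.ofFn H ∈ C)
    (h2 : List.ofFn Gs ++ List.ofFn H' ∈ C) :
    List.ofFn Gs ++ List.replicate (d + d' - 1) K ∈ C := by
  have hK' : ∀ a ∈ List.ofFn H, ∀ b ∈ List.ofFn H', a ⊔ b = K := by
    simpa [List.mem_ofFn] using hK
  simpa using hC.append_replicate_mem hK' h1 h2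

end
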